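/- arXiv:2505.12926 — 4 statements merged into one kernel-verified Lean document; each statement's English description precedes it below -/
import Mathlib

section
/- For any vectors a and b in a real inner product space with a ≠ 0, one has | ‖a + b‖ − ‖a‖ − ⟨a, b⟩/‖a‖ | ≤ 2 ‖b‖² / ‖a‖. -/
open scoped RealInnerProductSpace

/-- For vectors `a ≠ 0` and `b` in a real inner product space,
`| ‖a + b‖ − ‖a‖ − ⟨a, b⟩/‖a‖ | ≤ 2 ‖b‖² / ‖a‖`. -/
theorem stmt_2 {E : Type*} [NormedAddCommGroup E] [InnerProductSpace ℝ E]
    (a b : E) (ha : a ≠ 0) :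
    |‖a + b‖ - ‖a‖ - ⟪a, b⟫ / ‖a‖| ≤ 2 * ‖b‖ ^ 2 / ‖a‖ := by
  have hn : 0 < ‖a‖ := norm_pos_iff.mpr ha
  have h1 : ‖a + b‖ ^ 2 = ‖a‖ ^ 2 + 2 * ⟪a, b⟫ + ‖b‖ ^ 2 := norm_add_sq_real a b
  have h2 : |‖a + b‖ - ‖a‖| ≤ ‖b‖ := by
    simpa using abs_norm_sub_norm_le (a + b) a
  have h3 : (‖a + b‖ - ‖a‖) ^ 2 ≤ ‖b‖ ^ 2 := sq_le_sq' (abs_le.mp h2).1 (abs_le.mp h2).2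
  have h4 : ‖a + b‖ - ‖a‖ - ⟪a, b⟫ / ‖a‖
      = ((‖b‖ ^ 2 - (‖a + b‖ - ‖a‖) ^ 2) / 2) / ‖a‖ := by
    field_simp
    linarith
  rw [h4, abs_of_nonneg (div_nonneg (by linarith) hn.le)]
  apply div_le_div_of_nonneg_right _ hn.le
  nlinarith [sq_nonneg (‖a + b‖ - ‖a‖), sq_nonneg ‖b‖]
end

section
/- Let P be any set of integer vectors in ℤ^d. Then at least one of the following holds: (i) there is a non-zero vector v ∈ ℝ^d such that v · p ≥ 0 for all p ∈ P; (ii) there is a proper additive subgroup L of ℤ^d (L ≠ ℤ^d) containing every vector of P; (iii) there is a finite subset Q of P such that every vector z ∈ ℤ^d can be written as a finite sum z = q₁ + ⋯ + q_n with each q_i ∈ Q (repetitions allowed). -/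
open scoped NNReal

/-- The embedding of integer vectors into real vectors. -/
def castVec (d : ℕ) : (Fin d → ℤ) →+ (Fin d → ℝ) where
  toFun p := fun i => (p i : ℝ)
  map_zero' := by ext i; simp
  map_add' x y := by ext i; simp

/-- If minus `p` is a nonnegative real combination of vectors of `P`, then
minus `p` is in the monoid generated by `P`. -/
lemma neg_mem_of_cone {d : ℕ} {P : Set (Fin d → ℤ)} {p : Fin d → ℤ} (hp : p ∈ P)
    (h : -(castVec d p) ∈ Submodule.span ℝ≥0 (castVec d '' P)) :
    -p ∈ AddSubmonoid.closure P := by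
  obtain ⟨k, f, g, hfg⟩ := Submodule.mem_span_set'.1 h
  choose q hqP hq using fun i => (g i).2
  set y : ℕ → (Fin d → ℤ) := fun n => (∑ i, ⌊(n : ℝ≥0) * f i⌋₊ • q i) + n • p with hy
  have hcoord : ∀ j, ∑ i, (f i : ℝ) * (q i j : ℝ) = -(p j : ℝ) := by
    intro j
    have := congrFun hfg j
    simp only [Finset.sum_apply, Pi.smul_apply, ← hq] at this
    simpa [castVec, NNReal.smul_def] using this
  set B : Fin d → ℤ := fun j => ∑ i, |q i j| with hB
  have hmaps : Set.MapsTo y Set.univ (Set.Icc (-B) B) := by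
    intro n _
    have key : ∀ j, |(y n j : ℝ)| ≤ (B j : ℝ) := by
      intro j
      have h1 : (y n j : ℝ) =
          ∑ i, ((⌊(n : ℝ≥0) * f i⌋₊ : ℝ) - n * f i) * (q i j : ℝ) := by
        simp only [sub_mul, Finset.sum_sub_distrib, mul_assoc, ← Finset.mul_sum, hcoord]
        simp [hy]
      rw [h1, hB]
      push_cast
      refine (Finset.abs_sum_le_sum_abs _ _).trans (Finset.sum_le_sum fun i _ => ?_)
      rw [abs_mul]
      refine mul_le_of_le_one_left (abs_nonneg _) ?_
      have h2 : ((⌊(n : ℝ≥0) * f i⌋₊ : ℝ≥0) : ℝ) ≤ ((n : ℝ≥0) * f i : ℝ≥0) :=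
        NNReal.coe_le_coe.2 (Nat.floor_le (zero_le))
      have h3 : (((n : ℝ≥0) * f i : ℝ≥0) : ℝ) < ((⌊(n : ℝ≥0) * f i⌋₊ + 1 : ℝ≥0) : ℝ) :=
        NNReal.coe_lt_coe.2 (Nat.lt_floor_add_one _)
      push_cast at h2 h3
      rw [abs_le]
      constructor <;> linarith
    constructor
    · intro j
      have := (abs_le.1 (key j)).1
      simp only [Pi.neg_apply]
      exact_mod_cast this
    · intro j
      exact_mod_cast (abs_le.1 (key j)).2
  obtain ⟨a, -, b, -, hab, hyab⟩ :=
    Set.infinite_univ.exists_lt_map_eq_of_mapsTo hmaps (Set.finite_Icc _ _)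
  have hfl : ∀ i, ⌊(a : ℝ≥0) * f i⌋₊ ≤ ⌊(b : ℝ≥0) * f i⌋₊ := fun i =>
    Nat.floor_mono (by gcongr)
  choose e he using fun i => Nat.exists_eq_add_of_le (hfl i)
  obtain ⟨m, rfl⟩ := Nat.exists_eq_add_of_lt hab
  have hfin : -p = (∑ i, e i • q i) + m • p := by
    simp only [hy, he, add_smul, Finset.sum_add_distrib, one_smul] at hyab
    have h0 : (∑ i, e i • q i) + m • p + p = 0 := by
      have := sub_eq_zero.2 hyab.symm
      rw [← this]; abel
    exact (eq_neg_of_add_eq_zero_left h0).symm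
  rw [hfin]
  refine add_mem (sum_mem fun i _ => nsmul_mem (AddSubmonoid.subset_closure (hqP i)) _)
    (nsmul_mem (AddSubmonoid.subset_closure hp) _)

/-- A cone that spans and does not contain some point lies in a half space. -/
lemma exists_functional {d : ℕ} {P : Set (Fin d → ℤ)} {x : Fin d → ℝ}
    (hspan : Submodule.span ℝ (castVec d '' P) = ⊤)
    (hx : x ∉ Submodule.span ℝ≥0 (castVec d '' P)) :
    ∃ v : Fin d → ℝ, v ≠ 0 ∧ ∀ p ∈ P, 0 ≤ ∑ i, v i * (p i : ℝ) := by
  set C := Submodule.span ℝ≥0 (castVec d '' P) with hC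
  have hsm : ∀ (t : ℝ), 0 ≤ t → ∀ z ∈ C, t • z ∈ C := fun t ht z hz =>
    C.smul_mem (⟨t, ht⟩ : ℝ≥0) hz
  have hconv : Convex ℝ (C : Set (Fin d → ℝ)) := by
    intro u hu w hw s t hs ht _
    exact C.add_mem (hsm s hs u hu) (hsm t ht w hw)
  have haff : affineSpan ℝ (C : Set (Fin d → ℝ)) = ⊤ := by
    have h1 : (C : Set (Fin d → ℝ)) = insert 0 (C : Set (Fin d → ℝ)) :=
      (Set.insert_eq_of_mem C.zero_mem).symm
    have h2 : Submodule.span ℝ (C : Set (Fin d → ℝ)) = ⊤ := by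
      rw [eq_top_iff, ← hspan]
      exact Submodule.span_mono Submodule.subset_span
    apply SetLike.coe_injective
    rw [h1, affineSpan_insert_zero, h2]
    simp
  obtain ⟨f, hf0, hf⟩ := geometric_hahn_banach_of_nonempty_interior_point hconv
    (fun h => hx (interior_subset h)) (hconv.interior_nonempty_iff_affineSpan_eq_top.2 haff)
  have hexp : ∀ z : Fin d → ℝ, f z = ∑ i, z i * f (fun j => if i = j then 1 else 0) := by
    intro z
    have := LinearMap.pi_apply_eq_sum_univ f.toLinearMap z
    simpa using this
  refine ⟨fun i => - f (fun j => if i = j then 1 else 0), ?_, ?_⟩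
  · intro h
    apply hf0
    ext z
    rw [hexp]
    refine Finset.sum_eq_zero fun i _ => ?_
    have := congrFun h i
    simp only [Pi.zero_apply, neg_eq_zero] at this
    rw [this, mul_zero]
  · intro p hp
    have hpC : castVec d p ∈ C := Submodule.subset_span ⟨p, hp, rfl⟩
    have hle : f (castVec d p) ≤ 0 := by
      by_contra! hpos
      have := hf _ (hsm ((|f x| + 1) / f (castVec d p)) (by positivity) _ hpC)
      rw [map_smul, smul_eq_mul, div_mul_cancel₀ _ hpos.ne'] at this
      linarith [le_abs_self (f x)]
    rw [hexp] at hle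
    have : ∑ i, -f (fun j => if i = j then (1 : ℝ) else 0) * (p i : ℝ) =
        -∑ i, castVec d p i * f (fun j => if i = j then (1 : ℝ) else 0) := by
      rw [← Finset.sum_neg_distrib]
      refine Finset.sum_congr rfl fun i _ => ?_
      simp [castVec, mul_comm]
    rw [this]
    linarith

/-- If a set generates a finitely generated monoid, so does a finite subset. -/
lemma exists_finite_gen {d : ℕ} {P : Set (Fin d → ℤ)} (h : AddSubmonoid.closure P = ⊤) :
    ∃ Q : Finset (Fin d → ℤ), ↑Q ⊆ P ∧
      AddSubmonoid.closure (↑Q : Set (Fin d → ℤ)) = ⊤ := by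
  classical
  obtain ⟨S, hS⟩ := (inferInstance : AddMonoid.FG (Fin d → ℤ)).fg_top
  have hx : ∀ x : Fin d → ℤ, ∃ T : Finset (Fin d → ℤ), ↑T ⊆ P ∧
      x ∈ AddSubmonoid.closure (T : Set (Fin d → ℤ)) := by
    intro x
    have hmem : x ∈ Submodule.span ℕ P := by
      rw [← Submodule.mem_toAddSubmonoid, Submodule.span_nat_eq_addSubmonoidClosure, h]
      trivial
    obtain ⟨T, hT, hxT⟩ := Submodule.mem_span_finite_of_mem_span hmem
    rw [← Submodule.mem_toAddSubmonoid, Submodule.span_nat_eq_addSubmonoidClosure] at hxT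
    exact ⟨T, hT, hxT⟩
  choose T hT hxT using hx
  refine ⟨S.biUnion T, ?_, ?_⟩
  · intro z hz
    obtain ⟨s, -, hs⟩ := Finset.mem_biUnion.1 (Finset.mem_coe.1 hz)
    exact hT s hs
  · rw [eq_top_iff, ← hS, AddSubmonoid.closure_le]
    intro s hs
    refine AddSubmonoid.closure_mono ?_ (hxT s)
    exact_mod_cast Finset.subset_biUnion_of_mem T hs

/-- For any set `P` of integer vectors in `ℤ^d`, one of the following
holds: (i) some non-zero `v ∈ ℝ^d` has `v ⬝ p ≥ 0` for all `p ∈ P`; (ii) some proper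
additive subgroup of `ℤ^d` contains `P`; (iii) some finite subset `Q ⊆ P` is spanning,
i.e. every `z ∈ ℤ^d` is a finite sum (with repetitions) of elements of `Q`. -/
theorem stmt_7 (d : ℕ) (P : Set (Fin d → ℤ)) :
    (∃ v : Fin d → ℝ, v ≠ 0 ∧ ∀ p ∈ P, 0 ≤ ∑ i, v i * (p i : ℝ)) ∨
    (∃ L : AddSubgroup (Fin d → ℤ), L ≠ ⊤ ∧ ∀ p ∈ P, p ∈ L) ∨
    (∃ Q : Finset (Fin d → ℤ), ↑Q ⊆ P ∧
      AddSubmonoid.closure (↑Q : Set (Fin d → ℤ)) = ⊤) := by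
  by_cases h1 : ∃ v : Fin d → ℝ, v ≠ 0 ∧ ∀ p ∈ P, 0 ≤ ∑ i, v i * (p i : ℝ)
  · exact Or.inl h1
  by_cases h2 : ∃ L : AddSubgroup (Fin d → ℤ), L ≠ ⊤ ∧ ∀ p ∈ P, p ∈ L
  · exact Or.inr (Or.inl h2)
  refine Or.inr (Or.inr (exists_finite_gen ?_))
  have hgrp : ∀ L : AddSubgroup (Fin d → ℤ), (∀ p ∈ P, p ∈ L) → L = ⊤ := by
    intro L hL
    by_contra hne
    exact h2 ⟨L, hne, hL⟩
  have hspan : Submodule.span ℝ (castVec d '' P) = ⊤ := by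
    have hL := hgrp ((Submodule.span ℝ (castVec d '' P)).toAddSubgroup.comap (castVec d))
      (fun p hp => Submodule.subset_span (Set.mem_image_of_mem _ hp))
    have hall : ∀ z : Fin d → ℤ, castVec d z ∈ Submodule.span ℝ (castVec d '' P) := by
      intro z
      have : z ∈ (Submodule.span ℝ (castVec d '' P)).toAddSubgroup.comap (castVec d) := by
        rw [hL]; trivial
      exact this
    rw [eq_top_iff]
    intro x _
    rw [pi_eq_sum_univ x]
    refine Submodule.sum_mem _ fun i _ => Submodule.smul_mem _ _ ?_
    have := hall (fun j => if i = j then 1 else 0)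
    convert this using 1
    ext j
    simp [castVec]
  have hneg : ∀ p ∈ P, -p ∈ AddSubmonoid.closure P := by
    intro p hp
    apply neg_mem_of_cone hp
    by_contra hx
    exact h1 (exists_functional hspan hx)
  let L : AddSubgroup (Fin d → ℤ) :=
    { AddSubmonoid.closure P with
      neg_mem' := by
        intro x hx
        have hx' : x ∈ AddSubmonoid.closure P := hx
        change -x ∈ AddSubmonoid.closure P
        induction hx' using AddSubmonoid.closure_induction with
        | mem x h => exact hneg x h
        | zero => simp
        | add a b ha hb iha ihb =>
          rw [neg_add]
          exact add_mem (iha ha) (ihb hb) }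
  have hL : L = ⊤ := hgrp L fun p hp => AddSubmonoid.subset_closure hp
  rw [eq_top_iff]
  intro z _
  have : z ∈ L := by rw [hL]; trivial
  exact this
end

section
/- Let Q = {q₁, …, q_k} be a finite spanning subset of ℤ^d, and let ‖·‖ be any norm on ℝ^d. Then there are constants μ > 0 and ν > 0 such that every vector z ∈ ℤ^d can be written as z = p₁ + ⋯ + p_n where each p_i ∈ Q, n ≤ μ ‖z‖, and Σ_{i=1}^n ‖p_i‖ ≤ ν ‖z‖. -/
/-- The coercion of an integer vector to a real vector. -/
def castZ {d : ℕ} (x : Fin d → ℤ) : Fin d → ℝ := fun i => (x i : ℝ)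


theorem norm_bound {V : Type} [AddCommGroup V] [Module ℝ V] [FiniteDimensional ℝ V] {d : ℕ}
    (n : V → ℝ)
    (h0 : ∀ x, n x = 0 ↔ x = 0)
    (hadd : ∀ x y, n (x + y) ≤ n x + n y)
    (hsmul : ∀ (a : ℝ) (x : V), n (a • x) = |a| * n x)
    (hnn : ∀ x, 0 ≤ n x)
    (f : V →ₗ[ℝ] (Fin d → ℝ)) : ∃ C : ℝ, 0 < C ∧ ∀ v, ‖f v‖ ≤ C * n v := by
  let : Norm V := ⟨n⟩
  have core : NormedSpace.Core ℝ V :=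
    { norm_nonneg := hnn
      norm_smul := fun c x => by rw [Real.norm_eq_abs]; exact hsmul c x
      norm_triangle := hadd
      norm_eq_zero_iff := h0 }
  let := NormedAddCommGroup.ofCore core
  let := NormedSpace.ofCore core
  obtain ⟨C, hC, h⟩ := (LinearMap.toContinuousLinearMap f).bound
  exact ⟨C, hC, h⟩

/-- `z` is a sum of at most `m` elements of `Q`. -/
def QRep {d : ℕ} (Q : Finset (Fin d → ℤ)) (z : Fin d → ℤ) (m : ℕ) : Prop :=
  ∃ l : List (Fin d → ℤ), (∀ p ∈ l, p ∈ Q) ∧ l.sum = z ∧ l.length ≤ m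

theorem QRep.zero {d : ℕ} (Q : Finset (Fin d → ℤ)) : QRep Q 0 0 := ⟨[], by simp, rfl, le_rfl⟩

theorem QRep.add {d : ℕ} {Q : Finset (Fin d → ℤ)} {z w : Fin d → ℤ} {a b : ℕ}
    (h : QRep Q z a) (h' : QRep Q w b) : QRep Q (z + w) (a + b) := by
  obtain ⟨l, h1, h2, h3⟩ := h
  obtain ⟨l', h1', h2', h3'⟩ := h'
  refine ⟨l ++ l', ?_, by simp [h2, h2'], by simp; omega⟩
  intro p hp
  rcases List.mem_append.1 hp with h | h
  exacts [h1 p h, h1' p h]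

theorem QRep.nsmul {d : ℕ} {Q : Finset (Fin d → ℤ)} {z : Fin d → ℤ} {a : ℕ}
    (h : QRep Q z a) (k : ℕ) : QRep Q (k • z) (k * a) := by
  induction k with
  | zero => simpa using QRep.zero Q
  | succ k ih => rw [succ_nsmul, Nat.succ_mul]; exact ih.add h

theorem QRep.sum {d : ℕ} {Q : Finset (Fin d → ℤ)} {ι : Type} (s : Finset ι) (z : ι → Fin d → ℤ)
    (a : ι → ℕ) (h : ∀ i, QRep Q (z i) (a i)) : QRep Q (∑ i ∈ s, z i) (∑ i ∈ s, a i) := by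
  classical
  induction s using Finset.induction_on with
  | empty => simpa using QRep.zero Q
  | insert i s hi ih => rw [Finset.sum_insert hi, Finset.sum_insert hi]; exact (h i).add ih

theorem QRep.exists {d : ℕ} {Q : Finset (Fin d → ℤ)}
    (hspan : AddSubmonoid.closure (↑Q : Set (Fin d → ℤ)) = ⊤) (z : Fin d → ℤ) :
    ∃ m, QRep Q z m := by
  have hz : z ∈ AddSubmonoid.closure (↑Q : Set (Fin d → ℤ)) := by rw [hspan]; trivial
  obtain ⟨l, h1, h2⟩ := AddSubmonoid.exists_list_of_mem_closure hz
  exact ⟨l.length, l, fun p hp => by simpa using h1 p hp, h2, le_rfl⟩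

theorem QRep.main {d : ℕ} {Q : Finset (Fin d → ℤ)}
    (hspan : AddSubmonoid.closure (↑Q : Set (Fin d → ℤ)) = ⊤) :
    ∃ M : Fin d → ℕ, ∀ z : Fin d → ℤ, QRep Q z (∑ i, (z i).natAbs * M i) := by
  choose m hm using fun z => QRep.exists hspan z
  refine ⟨fun i => m (Pi.single i 1) + m (Pi.single i (-1)), fun z => ?_⟩
  have key : ∀ i, QRep Q (Pi.single i (z i))
      ((z i).natAbs * (m (Pi.single i 1) + m (Pi.single i (-1)))) := by
    intro i
    have : ∃ s : ℤ, (s = 1 ∨ s = -1) ∧ z i = (z i).natAbs * s := by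
      rcases le_total 0 (z i) with h | h
      · exact ⟨1, Or.inl rfl, by omega⟩
      · exact ⟨-1, Or.inr rfl, by omega⟩
    obtain ⟨s, hs, hz⟩ := this
    have h1 := (hm (Pi.single i s)).nsmul (z i).natAbs
    have h2 : (z i).natAbs • (Pi.single i s : Fin d → ℤ) = Pi.single i (z i) := by
      rw [← Pi.single_smul, nsmul_eq_mul, ← hz]
    rw [h2] at h1
    obtain ⟨l, a, b, c⟩ := h1
    refine ⟨l, a, b, c.trans (Nat.mul_le_mul_left _ ?_)⟩
    rcases hs with rfl | rfl <;> omega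
  have := QRep.sum Finset.univ _ _ key
  rwa [Finset.univ_sum_single] at this

/-- If `Q` is a finite spanning subset of `ℤ^d` and `n` is any norm on
`ℝ^d`, then there are constants `μ, ν > 0` such that every `z ∈ ℤ^d` can be written as a
sum of elements of `Q` of length at most `μ n(z)`, the sum of whose norms is at most
`ν n(z)`. -/
theorem stmt_8 (d : ℕ) (Q : Finset (Fin d → ℤ))
    (hspan : AddSubmonoid.closure (↑Q : Set (Fin d → ℤ)) = ⊤)
    (n : (Fin d → ℝ) → ℝ)
    (hn_eq_zero : ∀ x, n x = 0 ↔ x = 0)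
    (hn_add : ∀ x y, n (x + y) ≤ n x + n y)
    (hn_smul : ∀ (a : ℝ) (x : Fin d → ℝ), n (a • x) = |a| * n x) :
    ∃ μ ν : ℝ, 0 < μ ∧ 0 < ν ∧
      ∀ z : Fin d → ℤ, ∃ l : List (Fin d → ℤ),
        (∀ p ∈ l, p ∈ Q) ∧ l.sum = z ∧
        (l.length : ℝ) ≤ μ * n (castZ z) ∧
        (l.map fun p => n (castZ p)).sum ≤ ν * n (castZ z) := by
  have hnn : ∀ x, 0 ≤ n x := by
    intro x
    have h1 := hn_add x ((-1 : ℝ) • x)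
    rw [hn_smul] at h1
    have h2 : x + (-1 : ℝ) • x = 0 := by simp
    rw [h2, (hn_eq_zero 0).2 rfl] at h1
    simp at h1
    linarith
  obtain ⟨C, hC, hb⟩ := norm_bound n hn_eq_zero hn_add hn_smul hnn LinearMap.id
  obtain ⟨M, hM⟩ := QRep.main hspan
  have hKQ : ∀ p ∈ Q, n (castZ p) ≤ ∑ q ∈ Q, n (castZ q) := fun p hp =>
    Finset.single_le_sum (f := fun q => n (castZ q)) (fun q _ => hnn _) hp
  have hK0 : 0 ≤ ∑ q ∈ Q, n (castZ q) := Finset.sum_nonneg fun q _ => hnn _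
  set K := ∑ q ∈ Q, n (castZ q)
  set S : ℝ := ∑ i, (M i : ℝ)
  have hS : 0 ≤ S := Finset.sum_nonneg fun i _ => Nat.cast_nonneg _
  refine ⟨C * S + 1, K * (C * S + 1) + 1, by positivity, by positivity, fun z => ?_⟩
  obtain ⟨l, h1, h2, h3⟩ := hM z
  have hz := hnn (castZ z)
  have hlen : (l.length : ℝ) ≤ (C * S + 1) * n (castZ z) := by
    have h4 : (l.length : ℝ) ≤ ∑ i, C * n (castZ z) * (M i : ℝ) := by
      refine le_trans (Nat.cast_le.2 h3) ?_
      push_cast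
      refine Finset.sum_le_sum fun i _ => mul_le_mul_of_nonneg_right ?_ (Nat.cast_nonneg _)
      refine le_trans ?_ (hb (castZ z))
      refine le_trans ?_ (norm_le_pi_norm (castZ z) i)
      simp [castZ, Nat.cast_natAbs]
    rw [← Finset.mul_sum] at h4
    change _ ≤ C * n (castZ z) * S at h4
    nlinarith
  refine ⟨l, h1, h2, hlen, ?_⟩
  have h5 : (l.map fun p => n (castZ p)).sum ≤ (l.map fun p => n (castZ p)).length • K := by
    apply List.sum_le_card_nsmul
    intro x hx
    obtain ⟨p, hp, rfl⟩ := List.mem_map.1 hx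
    exact hKQ p (h1 p hp)
  rw [List.length_map, nsmul_eq_mul] at h5
  have := mul_le_mul_of_nonneg_right hlen hK0
  linarith
end

section
/- Let P be a set of integer vectors in ℤ^d and let V be the set of all finite sums of elements of P with repetitions allowed (the additive submonoid of ℤ^d generated by P). If z ∈ V and −z lies in the convex hull in ℝ^d of V, then −z ∈ V. -/
/-- Let `V` be the additive submonoid of `ℤ^d` generated by a set `P` of
integer vectors. If `z ∈ V` and `−z` lies in the convex hull (in `ℝ^d`) of `V`, then
`−z ∈ V`. -/
theorem stmt_9 (d : ℕ) (P : Set (Fin d → ℤ)) (z : Fin d → ℤ)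
    (hz : z ∈ AddSubmonoid.closure P)
    (hconv : castZ (-z) ∈
      convexHull ℝ (castZ '' ((AddSubmonoid.closure P : AddSubmonoid (Fin d → ℤ)) : Set (Fin d → ℤ)))) :
    -z ∈ AddSubmonoid.closure P := by
  obtain ⟨ι, _, p, w, hp, hai, hw0, hw1, hsum⟩ :=
    eq_pos_convex_span_of_mem_convexHull hconv
  have hv : ∀ i, ∃ v, v ∈ AddSubmonoid.closure P ∧ castZ v = p i := fun i => by
    obtain ⟨v, hv, h⟩ := hp (Set.mem_range_self i)
    exact ⟨v, hv, h⟩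
  choose v hvP hvp using hv
  -- a rational-linear retraction of the reals onto the rationals
  obtain ⟨f, hf⟩ := LinearMap.exists_leftInverse_of_injective (Algebra.linearMap ℚ ℝ)
    (LinearMap.ker_eq_bot.2 (by
      intro a b h
      simpa using h))
  have hfq : ∀ q : ℚ, f (q : ℝ) = q := fun q => by
    simpa using LinearMap.congr_fun hf q
  have hco : ∀ j, ∑ i, w i * (v i j : ℝ) = -(z j : ℝ) := fun j => by
    have := congrFun hsum j
    simp only [Finset.sum_apply, Pi.smul_apply, ← hvp, castZ, smul_eq_mul] at this
    simpa using this
  have hfz : ∀ (x : ℝ) (n : ℤ), f (x * n) = f x * n := fun x n => by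
    rw [mul_comm, ← zsmul_eq_mul, map_zsmul, zsmul_eq_mul, mul_comm]
  have hqco : ∀ j, ∑ i, f (w i) * (v i j : ℚ) = -(z j : ℚ) := fun j => by
    have := congrArg f (hco j)
    rw [map_sum] at this
    simp only [hfz] at this
    rw [this, map_neg]
    have := hfq (z j)
    push_cast at this
    rw [this]
  have hq1 : ∑ i, f (w i) = 1 := by
    have := congrArg f hw1
    rw [map_sum] at this
    rw [this]
    have := hfq 1
    push_cast at this
    exact this
  have hwq : ∀ i, w i = (f (w i) : ℝ) := fun i => by
    have h := (affineIndependent_iff.1 hai) Finset.univ (fun i => w i - (f (w i) : ℝ))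
      (by
        rw [Finset.sum_sub_distrib, hw1, ← Rat.cast_sum, hq1]; simp)
      (by
        funext j
        simp only [Finset.sum_apply, Pi.smul_apply, ← hvp, castZ, smul_eq_mul, sub_mul,
          Finset.sum_sub_distrib, Pi.zero_apply]
        rw [hco j]
        have := congrArg (fun q : ℚ => (q : ℝ)) (hqco j)
        push_cast at this
        rw [this]; simp) i (Finset.mem_univ i)
    linarith
  have hqpos : ∀ i, 0 ≤ f (w i) := fun i => by
    have := hw0 i
    rw [hwq i] at this
    exact_mod_cast this.le
  obtain ⟨N, hN, hn⟩ : ∃ N : ℕ, 0 < N ∧ ∀ i, ∃ n : ℕ, (n : ℚ) = N * f (w i) := by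
    refine ⟨∏ i, (f (w i)).den, Finset.prod_pos fun i _ => (f (w i)).den_pos, fun i => ?_⟩
    obtain ⟨k, hk⟩ := Finset.dvd_prod_of_mem (fun i => (f (w i)).den) (Finset.mem_univ i)
    refine ⟨k * (f (w i)).num.toNat, ?_⟩
    have h1 : (((f (w i)).num.toNat : ℤ) : ℚ) = (f (w i)).num := by
      rw [Int.toNat_of_nonneg (Rat.num_nonneg.2 (hqpos i))]
    have h2 := Rat.den_mul_eq_num (f (w i))
    rw [hk]
    push_cast at h1 ⊢
    rw [h1, ← h2]
    ring
  choose n hn using hn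
  have key : ∑ i, n i • v i = N • (-z) := by
    funext j
    have h : ∑ i, (n i : ℚ) * (v i j : ℚ) = N * -(z j : ℚ) := by
      rw [← hqco j, Finset.mul_sum]
      exact Finset.sum_congr rfl fun i _ => by rw [hn i]; ring
    simp only [Finset.sum_apply, Pi.smul_apply, Pi.neg_apply, nsmul_eq_mul]
    exact_mod_cast h
  obtain ⟨M, rfl⟩ : ∃ M, N = M + 1 := ⟨N - 1, by omega⟩
  have e : -z = (∑ i, n i • v i) + M • z := by
    rw [key, add_smul, one_smul, smul_neg]; abel
  rw [e]
  exact add_mem (sum_mem fun i _ => nsmul_mem (hvP i) _) (nsmul_mem hz _)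
end
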